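/- Let H be a connected tree–cycle block graph on a finite vertex set ι, and for every i ∈ ι let G_i be a connected finite simple graph with property (P), with an arbitrarily chosen bail vertex b_i in G_i. Then the threaded union T_H[𝒢] of the family 𝒢 = {(G_i, b_i)} over H has property (P), for every choice of bail vertices. -/

import Mathlib

open Matrix SimpleGraph

/-- A finite simple graph `G` has property (P) if there is a real symmetric matrix `A`
whose off-diagonal support is exactly the edge set of `G`, with `det A ≠ 0`, and such that
every principal submatrix obtained by deleting one row/column is singular. -/
def HasPropertyP {V : Type*} [Finite V] (G : SimpleGraph V) : Prop :=
  letI : Fintype V := Fintype.ofFinite V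
  letI : DecidableEq V := Classical.decEq V
  ∃ A : Matrix V V ℝ, A.IsSymm ∧
    (∀ u v : V, u ≠ v → (A u v ≠ 0 ↔ G.Adj u v)) ∧
    A.det ≠ 0 ∧
    ∀ v : V,
      (A.submatrix (fun x : {x : V // x ≠ v} => (x : V))
        (fun x : {x : V // x ≠ v} => (x : V))).det = 0


/-- The threaded union of the family of graphs `G i` (with bail vertices `b i`) over the
graph `H`: vertices `⟨i, x⟩` and `⟨j, y⟩` are adjacent iff either `i = j` and `x, y` are
adjacent in `G i`, or `i ≠ j`, `i` and `j` are adjacent in `H`, `x = b i` and `y = b j`. -/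
def threadedUnion {ι : Type*} (H : SimpleGraph ι) {V : ι → Type*}
    (G : ∀ i, SimpleGraph (V i)) (b : ∀ i, V i) : SimpleGraph (Σ i, V i) :=
  SimpleGraph.fromRel fun x y =>
    (∃ (i : ι) (u v : V i), (G i).Adj u v ∧ x = ⟨i, u⟩ ∧ y = ⟨i, v⟩) ∨
    (x.1 ≠ y.1 ∧ H.Adj x.1 y.1 ∧ x.2 = b x.1 ∧ y.2 = b y.1)

/-- A finite simple graph `H` is a tree–cycle block graph if, after deleting all bridges,
every connected component either is a single vertex, or has at least 3 vertices and its
induced subgraph is connected with every vertex of degree exactly 2 (i.e. it is a cycle). -/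
def IsTreeCycleBlock {ι : Type*} (H : SimpleGraph ι) : Prop :=
  ∀ C : (H.deleteEdges {e : Sym2 ι | H.IsBridge e}).ConnectedComponent,
    (∃ v, C.supp = {v}) ∨
    (3 ≤ C.supp.ncard ∧ (H.induce C.supp).Connected ∧
      ∀ v : C.supp, ((H.induce C.supp).neighborSet v).ncard = 2)

/-- A diagonal cofactor is the determinant of the principal submatrix. -/
lemma adjugate_diag_eq {V : Type*} [Fintype V] [DecidableEq V] (A : Matrix V V ℝ) (v : V) :
    A.adjugate v v = (A.submatrix (fun x : {x : V // x ≠ v} => (x : V))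
        (fun x : {x : V // x ≠ v} => (x : V))).det := by
  rw [Matrix.adjugate_apply,
    Matrix.twoBlockTriangular_det' _ (fun x => x = v)]
  · have h1 : (toSquareBlockProp (A.updateRow v (Pi.single v 1)) (fun x => x = v)).det = 1 := by
      have : toSquareBlockProp (A.updateRow v (Pi.single v 1)) (fun x => x = v) = 1 := by
        ext ⟨i, hi⟩ ⟨j, hj⟩
        subst hi
        subst hj
        simp [toSquareBlockProp]
      rw [this, Matrix.det_one]
    refine (congrArg₂ (· * ·) (?_ : _ = (1 : ℝ)) rfl).trans ?_
    · convert h1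
    rw [one_mul]
    congr 1
    ext ⟨i, hi⟩ ⟨j, hj⟩
    simp [toSquareBlockProp, Matrix.updateRow_apply, hi]
  · intro i hi j hj
    subst hi
    simp [hj]

/-- Property (P) says that some matrix with the given pattern has an inverse with zero diagonal. -/
lemma hasPropertyP_iff {V : Type*} [Fintype V] [DecidableEq V] (G : SimpleGraph V) :
    HasPropertyP G ↔ ∃ A B : Matrix V V ℝ, A.IsSymm ∧
      (∀ u v : V, u ≠ v → (A u v ≠ 0 ↔ G.Adj u v)) ∧ A * B = 1 ∧ ∀ v, B v v = 0 := by
  unfold HasPropertyP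
  constructor
  · rintro ⟨A, hs, hp, hd', hv⟩
    have hd : A.det ≠ 0 := by convert hd'
    refine ⟨A, A⁻¹, hs, hp, Matrix.mul_nonsing_inv A (isUnit_iff_ne_zero.mpr hd), fun v => ?_⟩
    have h := adjugate_diag_eq A v
    rw [Matrix.inv_def, Matrix.smul_apply, h]
    rw [show (A.submatrix (fun x : {x : V // x ≠ v} => (x : V))
        (fun x : {x : V // x ≠ v} => (x : V))).det = 0 by convert hv v, smul_zero]
  · rintro ⟨A, B, hs, hp, hAB, hv⟩
    have hd : A.det ≠ 0 := by
      intro h0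
      have := congrArg Matrix.det hAB
      rw [Matrix.det_mul, h0, zero_mul, Matrix.det_one] at this
      exact zero_ne_one this
    refine ⟨A, hs, hp, by convert hd, fun v => ?_⟩
    have h := adjugate_diag_eq A v
    have hB : A.adjugate = A.det • B := by
      calc A.adjugate = A.adjugate * (A * B) := by rw [hAB, mul_one]
        _ = A.det • B := by
          rw [← mul_assoc, Matrix.adjugate_mul, Matrix.smul_mul, one_mul]
    rw [hB, Matrix.smul_apply, hv v, smul_zero] at h
    convert h.symm

/-- If `H` is a connected tree–cycle block graph and each `G i` is a connected graph with
property (P), then the threaded union of the `G i` over `H` has property (P), for every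
choice of bail vertices. -/
theorem stmt_14 {ι : Type*} [Finite ι] (H : SimpleGraph ι)
    (hconn : H.Connected) (htcb : IsTreeCycleBlock H)
    {V : ι → Type*} [∀ i, Finite (V i)] (G : ∀ i, SimpleGraph (V i))
    (hGconn : ∀ i, (G i).Connected) (hGP : ∀ i, HasPropertyP (G i))
    (b : ∀ i, V i) :
    HasPropertyP (threadedUnion H G b) := by
  classical
  letI : Fintype ι := Fintype.ofFinite ι
  letI : ∀ i, Fintype (V i) := fun i => Fintype.ofFinite (V i)
  have hGP' := fun i => (hasPropertyP_iff (G i)).1 (hGP i)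
  choose A B hs hp hAB hB using hGP'
  rw [hasPropertyP_iff]
  let W : Matrix (Σ i, V i) (Σ i, V i) ℝ :=
    Matrix.of fun x y => if H.Adj x.1 y.1 ∧ x.2 = b x.1 ∧ y.2 = b y.1 then 1 else 0
  have hW : ∀ x y, W x y = if H.Adj x.1 y.1 ∧ x.2 = b x.1 ∧ y.2 = b y.1 then 1 else 0 :=
    fun x y => rfl
  have hABd : blockDiagonal' A * blockDiagonal' B = 1 := by
    rw [← blockDiagonal'_mul, ← blockDiagonal'_one]
    congr 1
    funext i
    exact hAB i
  have hWBW : W * blockDiagonal' B * W = 0 := by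
    ext x y
    rw [Matrix.mul_apply]
    refine Finset.sum_eq_zero fun w _ => ?_
    rw [Matrix.mul_apply, Finset.sum_mul]
    refine Finset.sum_eq_zero fun z _ => ?_
    obtain ⟨k, z⟩ := z
    obtain ⟨l, w⟩ := w
    rw [hW, hW]
    by_cases hz : z = b k
    · by_cases hw : w = b l
      · subst hz hw
        by_cases hkl : k = l
        · subst hkl
          simp [blockDiagonal'_apply_eq, hB]
        · simp [blockDiagonal'_apply_ne _ _ _ hkl]
      · simp [hw]
    · simp [hz]
  refine ⟨blockDiagonal' A + W, blockDiagonal' B - blockDiagonal' B * W * blockDiagonal' B,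
    ?_, ?_, ?_, ?_⟩
  · refine Matrix.IsSymm.add ?_ ?_
    · rw [Matrix.IsSymm, blockDiagonal'_transpose]
      congr 1
      funext i
      exact hs i
    · ext x y
      rw [Matrix.transpose_apply, hW, hW]
      congr 1
      rw [H.adj_comm]
      exact propext ⟨fun h => ⟨h.1, h.2.2, h.2.1⟩, fun h => ⟨h.1, h.2.2, h.2.1⟩⟩
  · rintro ⟨i, x⟩ ⟨j, y⟩ hne
    rw [Matrix.add_apply, hW]
    by_cases hij : i = j
    · subst hij
      have hxy : x ≠ y := fun h => hne (by rw [h])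
      have h1 : (threadedUnion H G b).Adj ⟨i, x⟩ ⟨i, y⟩ ↔ (G i).Adj x y := by
        simp only [threadedUnion, SimpleGraph.fromRel_adj]
        constructor
        · rintro ⟨-, (⟨k, u, v, h, hu, hv⟩ | h) | (⟨k, u, v, h, hu, hv⟩ | h)⟩
          · cases hu; cases hv; exact h
          · exact absurd rfl h.1
          · cases hu; cases hv; exact h.symm
          · exact absurd rfl h.1
        · intro h
          exact ⟨hne, Or.inl (Or.inl ⟨i, x, y, h, rfl, rfl⟩)⟩
      rw [h1, ← hp i x y hxy]
      simp [blockDiagonal'_apply_eq]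
    · have h1 : (threadedUnion H G b).Adj ⟨i, x⟩ ⟨j, y⟩ ↔ (H.Adj i j ∧ x = b i ∧ y = b j) := by
        simp only [threadedUnion, SimpleGraph.fromRel_adj]
        constructor
        · rintro ⟨-, (⟨k, u, v, h, hu, hv⟩ | h) | (⟨k, u, v, h, hu, hv⟩ | h)⟩
          · cases hu; cases hv; exact absurd rfl hij
          · exact h.2
          · cases hu; cases hv; exact absurd rfl hij
          · exact ⟨h.2.1.symm, h.2.2.2, h.2.2.1⟩
        · intro h
          exact ⟨hne, Or.inl (Or.inr ⟨hij, h⟩)⟩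
      rw [h1, blockDiagonal'_apply_ne _ _ _ hij, zero_add]
      simp
  · generalize blockDiagonal' A = A' at *
    generalize blockDiagonal' B = B' at *
    calc (A' + W) * (B' - B' * W * B')
        = A' * B' + W * B' - (A' * B') * W * B' - (W * B' * W) * B' := by noncomm_ring
      _ = 1 := by rw [hABd, hWBW]; simp
  · rintro ⟨i, x⟩
    rw [Matrix.sub_apply, blockDiagonal'_apply_eq, hB, zero_sub, neg_eq_zero, Matrix.mul_apply]
    refine Finset.sum_eq_zero fun w _ => ?_
    rw [Matrix.mul_apply, Finset.sum_mul]
    refine Finset.sum_eq_zero fun z _ => ?_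
    obtain ⟨k, z⟩ := z
    obtain ⟨l, w⟩ := w
    by_cases hk : i = k
    · by_cases hl : l = i
      · subst hl
        subst hk
        simp [hW]
      · simp [blockDiagonal'_apply_ne _ _ _ hl]
    · simp [blockDiagonal'_apply_ne _ _ _ hk]
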